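/- arXiv:1410.2653 — 5 statements merged into one kernel-verified Lean document; each statement's English description precedes it below -/
import Mathlib

section
/- Assume Θ is open and convex, the family is minimal (for every nonzero α ∈ ℝ^m, the function x ↦ ⟨α, φ(x)⟩ is not H-almost-everywhere constant), and log Z is differentiable on Θ with ∇ log Z(θ) = μ(θ) for all θ ∈ Θ. Let θ̂_1,…,θ̂_d ∈ Θ with φ being P_{θ̂_k}-integrable for each k. If θ_0 ∈ Θ satisfies μ(θ_0) = (1/d) Σ_{k=1}^d μ(θ̂_k), then θ_0 is the unique minimizer over Θ of the KL-averaging objective θ ↦ Σ_{k=1}^d KL(P_{θ̂_k} ‖ P_θ); that is, the KL-average equals μ^{-1} of the arithmetic mean of the local moment parameters. -/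
open MeasureTheory Real Finset
open scoped RealInnerProductSpace BigOperators

/-- The normalization constant `Z(θ) = ∫ exp ⟪θ, φ x⟫ dH(x)` of a full exponential family. -/
noncomputable def expZ {X : Type*} [MeasurableSpace X] (H : Measure X) {m : ℕ}
    (φ : X → EuclideanSpace ℝ (Fin m)) (θ : EuclideanSpace ℝ (Fin m)) : ℝ :=
  ∫ x, Real.exp ⟪θ, φ x⟫ ∂H

/-- The density `p(x|θ) = exp (⟪θ, φ x⟫ - log Z θ)` with respect to `H`. -/
noncomputable def expPdf {X : Type*} [MeasurableSpace X] (H : Measure X) {m : ℕ}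
    (φ : X → EuclideanSpace ℝ (Fin m)) (θ : EuclideanSpace ℝ (Fin m)) (x : X) : ℝ :=
  Real.exp (⟪θ, φ x⟫ - Real.log (expZ H φ θ))

/-- The moment parameter `μ(θ) = E_{P_θ}[φ] = ∫ p(x|θ) • φ(x) dH(x)`. -/
noncomputable def momentParam {X : Type*} [MeasurableSpace X] (H : Measure X) {m : ℕ}
    (φ : X → EuclideanSpace ℝ (Fin m)) (θ : EuclideanSpace ℝ (Fin m)) :
    EuclideanSpace ℝ (Fin m) :=
  ∫ x, expPdf H φ θ x • φ x ∂H

/-- The Kullback–Leibler divergence `KL(P_{θ₁} ‖ P_{θ₂}) = ∫ log (dP_{θ₁}/dP_{θ₂}) dP_{θ₁}`,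
expressed through the `H`-densities of the two members of the family. -/
noncomputable def klExp {X : Type*} [MeasurableSpace X] (H : Measure X) {m : ℕ}
    (φ : X → EuclideanSpace ℝ (Fin m)) (θ₁ θ₂ : EuclideanSpace ℝ (Fin m)) : ℝ :=
  ∫ x, expPdf H φ θ₁ x * (Real.log (expPdf H φ θ₁ x) - Real.log (expPdf H φ θ₂ x)) ∂H


section ExponentialFamily

variable {X : Type*} [MeasurableSpace X] {H : Measure X} {m : ℕ}
  {φ : X → EuclideanSpace ℝ (Fin m)} {θ θ₁ θ₂ v : EuclideanSpace ℝ (Fin m)}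

lemma expPdf_pos (x : X) : 0 < expPdf H φ θ x := Real.exp_pos _

lemma expPdf_eq_mul (x : X) :
    expPdf H φ θ x = Real.exp (-Real.log (expZ H φ θ)) * Real.exp ⟪θ, φ x⟫ := by
  rw [expPdf, ← Real.exp_add, neg_add_eq_sub]

lemma integrable_expPdf (hθ : Integrable (fun x => Real.exp ⟪θ, φ x⟫) H) :
    Integrable (expPdf H φ θ) H :=
  (hθ.const_mul _).congr (.of_forall fun x => (expPdf_eq_mul x).symm)

lemma integral_expPdf (hZ : 0 < expZ H φ θ) : ∫ x, expPdf H φ θ x ∂H = 1 := by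
  simp_rw [expPdf_eq_mul, integral_const_mul]
  change _ * expZ H φ θ = 1
  rw [Real.exp_neg, Real.exp_log hZ, inv_mul_cancel₀ hZ.ne']

lemma abs_le_exp_add_exp_neg (t : ℝ) : |t| ≤ Real.exp t + Real.exp (-t) := by
  have h₁ := Real.add_one_le_exp t
  have h₂ := Real.add_one_le_exp (-t)
  have h₃ := Real.exp_pos t
  have h₄ := Real.exp_pos (-t)
  exact abs_le.mpr ⟨by linarith, by linarith⟩

lemma integrable_exp_mul_inner (hφ : Measurable φ)
    (hadd : Integrable (fun x => Real.exp ⟪θ + v, φ x⟫) H)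
    (hsub : Integrable (fun x => Real.exp ⟪θ - v, φ x⟫) H) :
    Integrable (fun x => Real.exp ⟪θ, φ x⟫ * ⟪v, φ x⟫) H := by
  refine (hadd.add hsub).mono' (by fun_prop) (.of_forall fun x => ?_)
  rw [Pi.add_apply, inner_add_left, inner_sub_left, sub_eq_add_neg, Real.exp_add, Real.exp_add,
    ← mul_add, Real.norm_eq_abs, abs_mul, Real.abs_exp]
  gcongr
  exact abs_le_exp_add_exp_neg _

/-- At an interior point of the natural parameter space the sufficient statistic is integrable. -/
lemma integrable_expPdf_smul_of_mem_nhds (hφ : Measurable φ)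
    (hΘ : {t | Integrable (fun x => Real.exp ⟪t, φ x⟫) H} ∈ nhds θ) :
    Integrable (fun x => expPdf H φ θ x • φ x) H := by
  obtain ⟨ε, hε, hball⟩ := Metric.mem_nhds_iff.mp hΘ
  refine Integrable.of_eval_piLp fun i => ?_
  set v : EuclideanSpace ℝ (Fin m) := EuclideanSpace.single i (ε / 2) with hv
  have hnorm : ‖v‖ < ε := by
    rw [hv, PiLp.norm_single, Real.norm_eq_abs, abs_of_pos (by positivity)]
    linarith
  have hadd : θ + v ∈ Metric.ball θ ε := by simpa [dist_eq_norm] using hnorm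
  have hsub : θ - v ∈ Metric.ball θ ε := by simpa [dist_eq_norm] using hnorm
  refine ((integrable_exp_mul_inner hφ (hball hadd) (hball hsub)).const_mul
    (Real.exp (-Real.log (expZ H φ θ)) * (ε / 2)⁻¹)).congr (.of_forall fun x => ?_)
  simp only [hv, EuclideanSpace.inner_single_left, PiLp.smul_apply, smul_eq_mul,
    expPdf_eq_mul (θ := θ), conj_trivial]
  field_simp

lemma integrable_expPdf_mul_inner (hint : Integrable (fun x => expPdf H φ θ x • φ x) H) :
    Integrable (fun x => expPdf H φ θ x * ⟪v, φ x⟫) H := by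
  simpa only [real_inner_smul_right] using hint.const_inner (𝕜 := ℝ) v

lemma integral_expPdf_mul_inner (hint : Integrable (fun x => expPdf H φ θ x • φ x) H) :
    ∫ x, expPdf H φ θ x * ⟪v, φ x⟫ ∂H = ⟪v, momentParam H φ θ⟫ := by
  rw [momentParam, ← integral_inner hint]
  simp only [real_inner_smul_right]

lemma klExp_eq (hZ : 0 < expZ H φ θ₁) (hθ₁ : Integrable (fun x => Real.exp ⟪θ₁, φ x⟫) H)
    (hint : Integrable (fun x => expPdf H φ θ₁ x • φ x) H) :
    klExp H φ θ₁ θ₂ = ⟪θ₁ - θ₂, momentParam H φ θ₁⟫ +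
      (Real.log (expZ H φ θ₂) - Real.log (expZ H φ θ₁)) := by
  have hpt (x : X) : expPdf H φ θ₁ x *
      (Real.log (expPdf H φ θ₁ x) - Real.log (expPdf H φ θ₂ x)) =
      expPdf H φ θ₁ x * ⟪θ₁ - θ₂, φ x⟫ +
        expPdf H φ θ₁ x * (Real.log (expZ H φ θ₂) - Real.log (expZ H φ θ₁)) := by
    simp only [expPdf, Real.log_exp, inner_sub_left]
    ring
  simp_rw [klExp, hpt]
  rw [integral_add (integrable_expPdf_mul_inner hint) ((integrable_expPdf hθ₁).mul_const _),
    integral_expPdf_mul_inner hint, integral_mul_const, integral_expPdf hZ, one_mul]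

/-- The strict first-order convexity inequality for `log Z`. -/
lemma inner_momentParam_lt_log_expZ_sub
    (hZ₁ : 0 < expZ H φ θ₁) (hθ₁ : Integrable (fun x => Real.exp ⟪θ₁, φ x⟫) H)
    (hZ₂ : 0 < expZ H φ θ₂) (hθ₂ : Integrable (fun x => Real.exp ⟪θ₂, φ x⟫) H)
    (hint : Integrable (fun x => expPdf H φ θ₁ x • φ x) H)
    (hne : ¬ ∃ c : ℝ, (fun x => ⟪θ₂ - θ₁, φ x⟫) =ᵐ[H] fun _ => c) :
    ⟪θ₂ - θ₁, momentParam H φ θ₁⟫ < Real.log (expZ H φ θ₂) - Real.log (expZ H φ θ₁) := by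
  set D := Real.log (expZ H φ θ₂) - Real.log (expZ H φ θ₁) with hD
  have hlog (x : X) : expPdf H φ θ₂ x =
      expPdf H φ θ₁ x * Real.exp (⟪θ₂ - θ₁, φ x⟫ - D) := by
    rw [expPdf, expPdf, ← Real.exp_add, inner_sub_left, hD]
    ring_nf
  -- The integrand is `p₁ (eˢ - 1 - s)` with `s = log (p₂ / p₁)`.
  set g : X → ℝ := fun x => expPdf H φ θ₂ x - expPdf H φ θ₁ x -
    (expPdf H φ θ₁ x * ⟪θ₂ - θ₁, φ x⟫ - expPdf H φ θ₁ x * D) with hg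
  have hg_eq (x : X) : g x = expPdf H φ θ₁ x * (Real.exp (⟪θ₂ - θ₁, φ x⟫ - D) -
      ((⟪θ₂ - θ₁, φ x⟫ - D) + 1)) := by
    simp only [hg, hlog]
    ring
  have hp₁ := integrable_expPdf hθ₁
  have hp₂ := integrable_expPdf hθ₂
  have hs := integrable_expPdf_mul_inner (v := θ₂ - θ₁) hint
  have hg_int : Integrable g H := (hp₂.sub hp₁).sub (hs.sub (hp₁.mul_const D))
  have hg_nonneg : 0 ≤ g := fun x => by
    rw [hg_eq]
    exact mul_nonneg (expPdf_pos x).le (sub_nonneg.mpr (Real.add_one_le_exp _))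
  have hg_integral : ∫ x, g x ∂H = D - ⟪θ₂ - θ₁, momentParam H φ θ₁⟫ := by
    refine (integral_sub (hp₂.sub hp₁) (hs.sub (hp₁.mul_const D))).trans ?_
    simp only [Pi.sub_apply]
    rw [integral_sub hp₂ hp₁,
      integral_sub hs (hp₁.mul_const D), integral_expPdf hZ₁, integral_expPdf hZ₂,
      integral_expPdf_mul_inner hint, integral_mul_const, integral_expPdf hZ₁]
    ring
  have hg_ne : ∫ x, g x ∂H ≠ 0 := fun h0 => hne ⟨D, by
    filter_upwards [(integral_eq_zero_iff_of_nonneg hg_nonneg hg_int).mp h0] with x hx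
    rw [Pi.zero_apply, hg_eq, mul_eq_zero, or_iff_right (expPdf_pos x).ne', sub_eq_zero] at hx
    by_contra hxD
    exact (Real.add_one_lt_exp (sub_ne_zero.mpr hxD)).ne' hx⟩
  have := (integral_nonneg hg_nonneg).lt_of_ne' hg_ne
  linarith

end ExponentialFamily

/-- For a minimal full exponential family on an open convex `Θ` with
`∇ log Z = μ`, any `θ₀ ∈ Θ` whose moment parameter is the arithmetic mean of the local
moment parameters is the unique minimizer of the KL-averaging objective: the KL-average
equals `μ⁻¹` of the average of the local moment parameters. -/
theorem kl_average_eq_moment_mean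
    {X : Type*} [MeasurableSpace X] {m d : ℕ}
    (H : Measure X) [SigmaFinite H]
    (φ : X → EuclideanSpace ℝ (Fin m)) (hφ : Measurable φ)
    (Θ : Set (EuclideanSpace ℝ (Fin m)))
    (hΘopen : IsOpen Θ) (hΘconv : Convex ℝ Θ)
    (hΘ : ∀ θ ∈ Θ, 0 < expZ H φ θ ∧ Integrable (fun x => Real.exp ⟪θ, φ x⟫) H)
    (hminimal : ∀ a : EuclideanSpace ℝ (Fin m), a ≠ 0 →
      ¬ ∃ c : ℝ, (fun x => ⟪a, φ x⟫) =ᵐ[H] fun _ => c)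
    (hgrad : ∀ θ ∈ Θ, HasGradientAt (fun t => Real.log (expZ H φ t)) (momentParam H φ θ) θ)
    (hd : 0 < d)
    (θhat : Fin d → EuclideanSpace ℝ (Fin m))
    (hmem : ∀ k, θhat k ∈ Θ)
    (hint : ∀ k, Integrable (fun x => expPdf H φ (θhat k) x • φ x) H)
    (θ₀ : EuclideanSpace ℝ (Fin m)) (hθ₀ : θ₀ ∈ Θ)
    (hμ₀ : momentParam H φ θ₀ = ((d : ℝ))⁻¹ • ∑ k, momentParam H φ (θhat k)) :
    ∀ θ ∈ Θ, θ ≠ θ₀ →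
      ∑ k, klExp H φ (θhat k) θ₀ < ∑ k, klExp H φ (θhat k) θ := by
  intro θ hθ hne
  have hd' : (0 : ℝ) < d := by exact_mod_cast hd
  have hint₀ : Integrable (fun x => expPdf H φ θ₀ x • φ x) H :=
    integrable_expPdf_smul_of_mem_nhds hφ
      (Filter.mem_of_superset (hΘopen.mem_nhds hθ₀) fun t ht => (hΘ t ht).2)
  have hlt := inner_momentParam_lt_log_expZ_sub (hΘ θ₀ hθ₀).1 (hΘ θ₀ hθ₀).2 (hΘ θ hθ).1
    (hΘ θ hθ).2 hint₀ (hminimal _ (sub_ne_zero.mpr hne))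
  have hsum : ∑ k, momentParam H φ (θhat k) = (d : ℝ) • momentParam H φ θ₀ := by
    rw [hμ₀, smul_inv_smul₀ hd'.ne']
  have hdiff : ∑ k, klExp H φ (θhat k) θ - ∑ k, klExp H φ (θhat k) θ₀ =
      d * (Real.log (expZ H φ θ) - Real.log (expZ H φ θ₀) -
        ⟪θ - θ₀, momentParam H φ θ₀⟫) := by
    have hk (k : Fin d) : klExp H φ (θhat k) θ - klExp H φ (θhat k) θ₀ =
        Real.log (expZ H φ θ) - Real.log (expZ H φ θ₀) -
          ⟪θ - θ₀, momentParam H φ (θhat k)⟫ := by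
      have hk' := hΘ _ (hmem k)
      rw [klExp_eq hk'.1 hk'.2 (hint k), klExp_eq hk'.1 hk'.2 (hint k)]
      simp only [inner_sub_left]
      ring
    rw [← Finset.sum_sub_distrib]
    simp_rw [hk]
    rw [Finset.sum_sub_distrib, ← inner_sum, hsum, real_inner_smul_right]
    simp only [Finset.sum_const, Finset.card_univ, Fintype.card_fin, nsmul_eq_mul]
    ring
  rw [← sub_pos, hdiff]
  exact mul_pos hd' (sub_pos.mpr hlt)
end

section
/- Assume Θ is an open convex subset of {θ ∈ ℝ^m : Z(θ) < ∞} and the exponential family is minimal: for every nonzero α ∈ ℝ^m, the function x ↦ ⟨α, φ(x)⟩ is not H-almost-everywhere equal to a constant. Then the log-partition function θ ↦ log Z(θ) is strictly convex on Θ; consequently, if log Z is differentiable on Θ, its gradient map θ ↦ ∇ log Z(θ) (the map from natural parameters to moment parameters) is injective on Θ. -/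
open MeasureTheory Real Finset
open scoped RealInnerProductSpace BigOperators

/-- Strict log-convexity of `f ↦ ∫ exp f`: the case of strict inequality in Hölder's inequality. -/
theorem log_integral_exp_lt_of_not_ae_eq_const_add {X : Type*} [MeasurableSpace X] {μ : Measure X}
    {f g : X → ℝ} (hf : Integrable (fun x => exp (f x)) μ)
    (hg : Integrable (fun x => exp (g x)) μ)
    (hfg : ¬ ∃ c : ℝ, (fun x => f x - g x) =ᵐ[μ] fun _ => c)
    {a b : ℝ} (ha : 0 < a) (hb : 0 < b) (hab : a + b = 1) :
    log (∫ x, exp (a * f x + b * g x) ∂μ) <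
      a * log (∫ x, exp (f x) ∂μ) + b * log (∫ x, exp (g x) ∂μ) := by
  have : NeZero μ := ⟨by
    rintro rfl
    exact hfg ⟨0, by simp [Filter.EventuallyEq]⟩⟩
  have hF : 0 < ∫ x, exp (f x) ∂μ := integral_exp_pos hf
  have hG : 0 < ∫ x, exp (g x) ∂μ := integral_exp_pos hg
  set F := ∫ x, exp (f x) ∂μ
  set G := ∫ x, exp (g x) ∂μ
  set C := a * log F + b * log G
  have hexp (x : X) : exp (a * (f x - log F) + b * (g x - log G)) =
      exp (a * f x + b * g x) / exp C := by
    rw [← exp_sub]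
    congr 1
    ring
  have hle (x : X) : exp (a * f x + b * g x) / exp C ≤
      a * (exp (f x) / F) + b * (exp (g x) / G) := by
    have h := convexOn_exp.2 (Set.mem_univ (f x - log F)) (Set.mem_univ (g x - log G))
      ha.le hb.le hab
    simpa only [smul_eq_mul, hexp, exp_sub, exp_log hF, exp_log hG] using h
  have hmeas : AEMeasurable (fun x => a * f x + b * g x) μ :=
    ((aemeasurable_of_aemeasurable_exp hf.aemeasurable).const_mul a).add
      ((aemeasurable_of_aemeasurable_exp hg.aemeasurable).const_mul b)
  have hR : Integrable (fun x => a * (exp (f x) / F) + b * (exp (g x) / G)) μ :=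
    ((hf.div_const F).const_mul a).add ((hg.div_const G).const_mul b)
  have hL : Integrable (fun x => exp (a * f x + b * g x) / exp C) μ := by
    refine hR.mono' (hmeas.exp.div_const _).aestronglyMeasurable (.of_forall fun x => ?_)
    rw [norm_of_nonneg (by positivity)]
    exact hle x
  have hRint : ∫ x, (a * (exp (f x) / F) + b * (exp (g x) / G)) ∂μ = 1 := by
    rw [integral_add ((hf.div_const F).const_mul a) ((hg.div_const G).const_mul b),
      integral_const_mul, integral_const_mul, integral_div, integral_div,
      div_self hF.ne', div_self hG.ne', mul_one, mul_one, hab]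
  have hlt : ∫ x, exp (a * f x + b * g x) / exp C ∂μ < 1 := by
    rw [← hRint]
    refine (integral_mono hL hR hle).lt_of_ne fun heq => hfg ⟨log F - log G, ?_⟩
    filter_upwards [(integral_eq_iff_of_ae_le hL hR (.of_forall hle)).1 heq] with x hx
    by_contra hne
    have h := strictConvexOn_exp.2 (Set.mem_univ (f x - log F)) (Set.mem_univ (g x - log G))
      (fun h => hne (by linarith)) ha hb hab
    simp only [smul_eq_mul, hexp, exp_sub, exp_log hF, exp_log hG] at h
    exact h.ne hx
  rw [integral_div, div_lt_one (exp_pos C)] at hlt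
  have hpos : 0 < ∫ x, exp (a * f x + b * g x) ∂μ := by
    refine integral_exp_pos ?_
    simpa [div_mul_cancel₀ _ (exp_pos C).ne'] using hL.mul_const (exp C)
  exact (log_lt_iff_lt_exp hpos).2 hlt

/-- The gradient of a strictly convex function is injective. -/
theorem StrictConvexOn.injOn_of_hasGradientAt {E : Type*} [NormedAddCommGroup E]
    [InnerProductSpace ℝ E] [CompleteSpace E] {s : Set E} {f : E → ℝ} {g : E → E}
    (hf : StrictConvexOn ℝ s f) (hg : ∀ x ∈ s, HasGradientAt f (g x) x) : Set.InjOn g s := by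
  intro x hx y hy hxy
  by_contra hne
  have hmem {t : ℝ} (ht : t ∈ Set.Icc (0 : ℝ) 1) : AffineMap.lineMap x y t ∈ s :=
    hf.1.lineMap_mem hx hy ht
  have hline : StrictConvexOn ℝ (Set.Icc (0 : ℝ) 1) (fun t => f (AffineMap.lineMap x y t)) := by
    refine ⟨convex_Icc 0 1, fun t ht u hu htu a b ha hb hab => ?_⟩
    have h := hf.2 (hmem ht) (hmem hu) ((AffineMap.lineMap_injective ℝ hne).ne htu) ha hb hab
    rwa [← Convex.combo_affine_apply hab] at h
  have hderiv {t : ℝ} (ht : t ∈ Set.Icc (0 : ℝ) 1) :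
      HasDerivAt (fun t => f (AffineMap.lineMap x y t))
        ⟪g (AffineMap.lineMap x y t), y - x⟫ t := by
    simpa [Function.comp_def] using
      (hg _ (hmem ht)).hasFDerivAt.comp_hasDerivAt t AffineMap.hasDerivAt_lineMap
  have h0 : (0 : ℝ) ∈ Set.Icc (0 : ℝ) 1 := by simp
  have h1 : (1 : ℝ) ∈ Set.Icc (0 : ℝ) 1 := by simp
  have h := (hline.lt_slope_of_hasDerivAt h0 h1 one_pos (hderiv h0)).trans
    (hline.slope_lt_of_hasDerivAt h0 h1 one_pos (hderiv h1))
  simp [hxy] at h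

/-- For a minimal exponential family, the log-partition function
`θ ↦ log Z θ` is strictly convex on an open convex `Θ ⊆ {Z < ∞}`; consequently, if it is
differentiable on `Θ` then its gradient map (natural → moment parameters) is injective
on `Θ`. -/
theorem logZ_strictConvexOn_and_gradient_injective
    {X : Type*} [MeasurableSpace X] {m : ℕ}
    (H : Measure X) [SigmaFinite H]
    (φ : X → EuclideanSpace ℝ (Fin m)) (hφ : Measurable φ)
    (Θ : Set (EuclideanSpace ℝ (Fin m)))
    (hΘopen : IsOpen Θ) (hΘconv : Convex ℝ Θ)
    (hΘ : ∀ θ ∈ Θ, Integrable (fun x => Real.exp ⟪θ, φ x⟫) H)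
    (hminimal : ∀ a : EuclideanSpace ℝ (Fin m), a ≠ 0 →
      ¬ ∃ c : ℝ, (fun x => ⟪a, φ x⟫) =ᵐ[H] fun _ => c) :
    StrictConvexOn ℝ Θ (fun θ => Real.log (expZ H φ θ)) ∧
      ∀ g : EuclideanSpace ℝ (Fin m) → EuclideanSpace ℝ (Fin m),
        (∀ θ ∈ Θ, HasGradientAt (fun t => Real.log (expZ H φ t)) (g θ) θ) →
          Set.InjOn g Θ := by
  have hconv : StrictConvexOn ℝ Θ (fun θ => Real.log (expZ H φ θ)) := by
    refine ⟨hΘconv, fun x hx y hy hxy a b ha hb hab => ?_⟩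
    have h := log_integral_exp_lt_of_not_ae_eq_const_add (hΘ x hx) (hΘ y hy)
      (by simpa only [inner_sub_left] using hminimal (x - y) (sub_ne_zero.2 hxy)) ha hb hab
    simpa only [expZ, inner_add_left, real_inner_smul_left, smul_eq_mul] using h
  exact ⟨hconv, fun g hg => hconv.injOn_of_hasGradientAt hg⟩
end

section
/- Let Σ be a real m×m symmetric positive definite matrix, D a real m×q matrix with I₀ := DᵀΣD invertible, N = Id_m − Σ D I₀⁻¹ Dᵀ, and let A_1,…,A_q be arbitrary real m×q matrices. Define G_{i0} = D I₀⁻¹ A_iᵀ N and Λ_{ij} = tr( I₀⁻¹ A_iᵀ N Σ Nᵀ A_j ). Then for all i, j ∈ {1,…,q}: (i) tr(G_{i0} Σ) = 0; (ii) tr(G_{i0} Σ G_{j0} Σ) = 0; (iii) tr(G_{i0} Σ G_{j0}ᵀ Σ) = Λ_{ij}; and (iv) Λ is symmetric: Λ_{ij} = Λ_{ji}. -/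
open Matrix
open scoped BigOperators

/-- Trace identities underlying the KL-averaging analysis: with `S`
symmetric positive definite, `I₀ = DᵀSD` invertible, `N = 1 − S D I₀⁻¹ Dᵀ`,
`G_{i0} = D I₀⁻¹ A_iᵀ N` and `Λ_{ij} = tr(I₀⁻¹ A_iᵀ N S Nᵀ A_j)`, one has
`tr(G_{i0} S) = 0`, `tr(G_{i0} S G_{j0} S) = 0`, `tr(G_{i0} S G_{j0}ᵀ S) = Λ_{ij}` and
`Λ_{ij} = Λ_{ji}`. -/
theorem kl_averaging_trace_identities {m q : ℕ}
    (S : Matrix (Fin m) (Fin m) ℝ) (hS : S.PosDef)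
    (D : Matrix (Fin m) (Fin q) ℝ) (hI : IsUnit (Dᵀ * S * D))
    (A : Fin q → Matrix (Fin m) (Fin q) ℝ) :
    ∀ i j : Fin q,
      Matrix.trace
        ((D * (Dᵀ * S * D)⁻¹ * (A i)ᵀ * (1 - S * D * (Dᵀ * S * D)⁻¹ * Dᵀ)) * S) = 0
      ∧ Matrix.trace
          ((D * (Dᵀ * S * D)⁻¹ * (A i)ᵀ * (1 - S * D * (Dᵀ * S * D)⁻¹ * Dᵀ)) * S *
            (D * (Dᵀ * S * D)⁻¹ * (A j)ᵀ * (1 - S * D * (Dᵀ * S * D)⁻¹ * Dᵀ)) * S) = 0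
      ∧ Matrix.trace
          ((D * (Dᵀ * S * D)⁻¹ * (A i)ᵀ * (1 - S * D * (Dᵀ * S * D)⁻¹ * Dᵀ)) * S *
            (D * (Dᵀ * S * D)⁻¹ * (A j)ᵀ * (1 - S * D * (Dᵀ * S * D)⁻¹ * Dᵀ))ᵀ * S)
        = Matrix.trace
            ((Dᵀ * S * D)⁻¹ * (A i)ᵀ * (1 - S * D * (Dᵀ * S * D)⁻¹ * Dᵀ) * S *
              (1 - S * D * (Dᵀ * S * D)⁻¹ * Dᵀ)ᵀ * (A j))
      ∧ Matrix.trace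
          ((Dᵀ * S * D)⁻¹ * (A i)ᵀ * (1 - S * D * (Dᵀ * S * D)⁻¹ * Dᵀ) * S *
            (1 - S * D * (Dᵀ * S * D)⁻¹ * Dᵀ)ᵀ * (A j))
        = Matrix.trace
            ((Dᵀ * S * D)⁻¹ * (A j)ᵀ * (1 - S * D * (Dᵀ * S * D)⁻¹ * Dᵀ) * S *
              (1 - S * D * (Dᵀ * S * D)⁻¹ * Dᵀ)ᵀ * (A i)) := by
  have hSt : Sᵀ = S := by simpa using hS.isHermitian.eq
  have hdet := (Matrix.isUnit_iff_isUnit_det _).mp hI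
  have hNSD : (1 - S * D * (Dᵀ * S * D)⁻¹ * Dᵀ) * (S * D) = 0 := by
    have h : S * D * (Dᵀ * S * D)⁻¹ * Dᵀ * (S * D) = S * D := by
      calc S * D * (Dᵀ * S * D)⁻¹ * Dᵀ * (S * D)
          = S * D * ((Dᵀ * S * D)⁻¹ * (Dᵀ * S * D)) := by simp only [Matrix.mul_assoc]
        _ = S * D := by rw [Matrix.nonsing_inv_mul _ hdet, Matrix.mul_one]
    rw [Matrix.sub_mul, Matrix.one_mul, h, sub_self]
  have hKt : ((Dᵀ * S * D)⁻¹)ᵀ = (Dᵀ * S * D)⁻¹ := by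
    rw [Matrix.transpose_nonsing_inv]
    simp only [Matrix.transpose_mul, Matrix.transpose_transpose, hSt, Matrix.mul_assoc]
  have hKI : (Dᵀ * S * D)⁻¹ * (Dᵀ * (S * D)) = 1 := by
    rw [← Matrix.mul_assoc Dᵀ, Matrix.nonsing_inv_mul _ hdet]
  generalize 1 - S * D * (Dᵀ * S * D)⁻¹ * Dᵀ = N at *
  generalize (Dᵀ * S * D)⁻¹ = K at *
  have hNSD_mul (X : Matrix (Fin q) (Fin m) ℝ) : N * (S * (D * X)) = 0 := by
    rw [← Matrix.mul_assoc S, ← Matrix.mul_assoc N, hNSD, Matrix.zero_mul]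
  intro i j
  refine ⟨?_, ?_, ?_, ?_⟩
  · simp only [Matrix.mul_assoc]
    rw [Matrix.trace_mul_comm]
    simp only [Matrix.mul_assoc, hNSD, Matrix.mul_zero, Matrix.trace_zero]
  · simp only [Matrix.mul_assoc, hNSD_mul, Matrix.mul_zero, Matrix.zero_mul, Matrix.trace_zero]
  · simp only [Matrix.transpose_mul, Matrix.transpose_transpose, hKt, Matrix.mul_assoc]
    rw [Matrix.trace_mul_comm]
    simp only [Matrix.mul_assoc, hKI, Matrix.mul_one]
  · rw [← Matrix.trace_transpose]
    simp only [Matrix.transpose_mul, Matrix.transpose_transpose, hKt, hSt, ← Matrix.mul_assoc]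
    rw [Matrix.trace_mul_comm]
    simp only [Matrix.mul_assoc]
end

section
/- Let Σ be a real m×m symmetric positive definite matrix and u, v ∈ ℝ^m with I₀ := uᵀΣu > 0 (u plays the role of η̇ and v of η̈ for a one-dimensional parameter), let N = Id_m − Σ u I₀⁻¹ uᵀ, and let J ∈ ℝ. Define L₀ = v I₀⁻¹ uᵀ + (1/2) u I₀⁻¹ J I₀⁻¹ uᵀ (an m×m matrix), L = (L₀ + L₀ᵀ)/2, B = I₀⁻¹ ( uᵀΣv + J/2 ) ∈ ℝ, and Λ = I₀⁻¹ vᵀ N Σ Nᵀ v. Then: (i) tr(L Σ) = B; (ii) tr(L₀ Σ L₀ Σ) = B²; (iii) tr(L₀ Σ L₀ᵀ Σ) = B² + Λ; and hence (iv) tr(L Σ L Σ) = B² + Λ/2. -/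
open Matrix

theorem trace_vecMulVec_mul {n R : Type*} [Fintype n] [CommSemiring R]
    (S : Matrix n n R) (a b : n → R) :
    trace (vecMulVec a b * S) = b ⬝ᵥ S *ᵥ a := by
  rw [vecMulVec_mul, trace_vecMulVec, dotProduct_comm, dotProduct_mulVec]

theorem trace_vecMulVec_mul_vecMulVec_mul {n R : Type*} [Fintype n] [CommSemiring R]
    (S : Matrix n n R) (a b c d : n → R) :
    trace (vecMulVec a b * S * vecMulVec c d * S) = (b ⬝ᵥ S *ᵥ c) * (d ⬝ᵥ S *ᵥ a) := by
  rw [vecMulVec_mul, vecMulVec_mul_vecMulVec, trace_vecMulVec_mul, smul_dotProduct,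
    smul_eq_mul, dotProduct_mulVec b]

theorem dotProduct_mulVec_comm_of_transpose_eq {n R : Type*} [Fintype n] [CommSemiring R]
    {S : Matrix n n R} (hS : Sᵀ = S) (a b : n → R) :
    a ⬝ᵥ S *ᵥ b = b ⬝ᵥ S *ᵥ a := by
  rw [dotProduct_mulVec, ← mulVec_transpose, hS, dotProduct_comm]

theorem dotProduct_mul_mul_transpose_mulVec {n R : Type*} [Fintype n] [CommSemiring R]
    (N S : Matrix n n R) (v : n → R) :
    v ⬝ᵥ (N * S * Nᵀ) *ᵥ v = (Nᵀ *ᵥ v) ⬝ᵥ S *ᵥ (Nᵀ *ᵥ v) := by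
  rw [← mulVec_mulVec, ← mulVec_mulVec, dotProduct_mulVec v N, ← mulVec_transpose]

/-- Scalar-parameter trace identities underlying the linear-averaging
analysis: with `I₀ = uᵀSu > 0`, `N = 1 − S u I₀⁻¹ uᵀ`,
`L₀ = v I₀⁻¹ uᵀ + (1/2) u I₀⁻¹ J I₀⁻¹ uᵀ`, `L = (L₀ + L₀ᵀ)/2`,
`B = I₀⁻¹ (uᵀSv + J/2)` and `Λ = I₀⁻¹ vᵀ N S Nᵀ v`, one has `tr(L S) = B`,
`tr(L₀ S L₀ S) = B²`, `tr(L₀ S L₀ᵀ S) = B² + Λ` and `tr(L S L S) = B² + Λ/2`. -/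
theorem linear_averaging_trace_identities {m : ℕ}
    (S : Matrix (Fin m) (Fin m) ℝ) (hS : S.PosDef)
    (u v : Fin m → ℝ) (hI : 0 < u ⬝ᵥ S.mulVec u) (J : ℝ)
    (I₀ : ℝ) (hI₀ : I₀ = u ⬝ᵥ S.mulVec u)
    (N : Matrix (Fin m) (Fin m) ℝ) (hN : N = 1 - I₀⁻¹ • vecMulVec (S.mulVec u) u)
    (L₀ : Matrix (Fin m) (Fin m) ℝ)
    (hL₀ : L₀ = I₀⁻¹ • vecMulVec v u + (((1 : ℝ) / 2) * I₀⁻¹ * J * I₀⁻¹) • vecMulVec u u)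
    (L : Matrix (Fin m) (Fin m) ℝ) (hL : L = ((1 : ℝ) / 2) • (L₀ + L₀ᵀ))
    (B : ℝ) (hB : B = I₀⁻¹ * (u ⬝ᵥ S.mulVec v + J / 2))
    (Λ : ℝ) (hΛ : Λ = I₀⁻¹ * (v ⬝ᵥ (N * S * Nᵀ).mulVec v)) :
    Matrix.trace (L * S) = B
    ∧ Matrix.trace (L₀ * S * L₀ * S) = B ^ 2
    ∧ Matrix.trace (L₀ * S * L₀ᵀ * S) = B ^ 2 + Λ
    ∧ Matrix.trace (L * S * L * S) = B ^ 2 + Λ / 2 := by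
  have hsymm : Sᵀ = S := by simpa using hS.isHermitian.eq
  have hpos : I₀ ≠ 0 := by rw [hI₀]; exact hI.ne'
  have hvu : v ⬝ᵥ S *ᵥ u = u ⬝ᵥ S *ᵥ v := dotProduct_mulVec_comm_of_transpose_eq hsymm v u
  obtain ⟨w, hw⟩ : ∃ w, w = I₀⁻¹ • v + ((1 : ℝ) / 2 * I₀⁻¹ * J * I₀⁻¹) • u := ⟨_, rfl⟩
  have hL₀w : L₀ = vecMulVec w u := by
    rw [hL₀, hw, add_vecMulVec, smul_vecMulVec, smul_vecMulVec]
  have hL₀t : L₀ᵀ = vecMulVec u w := by rw [hL₀w, transpose_vecMulVec]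
  have huw : u ⬝ᵥ S *ᵥ w = B := by
    rw [hB, hw]
    simp only [mulVec_add, mulVec_smul, dotProduct_add, dotProduct_smul, smul_eq_mul, ← hI₀]
    field_simp
  have hwu : w ⬝ᵥ S *ᵥ u = B := by
    rw [dotProduct_mulVec_comm_of_transpose_eq hsymm, huw]
  have hNv : Nᵀ *ᵥ v = v - (I₀⁻¹ * (u ⬝ᵥ S *ᵥ v)) • u := by
    rw [hN, transpose_sub, transpose_one, transpose_smul, transpose_vecMulVec, sub_mulVec,
      one_mulVec, smul_mulVec, vecMulVec_mulVec, dotProduct_comm, hvu]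
    simp [smul_smul]
  have hww : I₀ * (w ⬝ᵥ S *ᵥ w) = B ^ 2 + Λ := by
    rw [hΛ, dotProduct_mul_mul_transpose_mulVec, hNv, hB, hw]
    simp only [mulVec_add, mulVec_sub, mulVec_smul, dotProduct_add, dotProduct_sub,
      add_dotProduct, sub_dotProduct, smul_dotProduct, dotProduct_smul, smul_eq_mul, ← hI₀, hvu]
    field_simp
    ring
  have htr : trace (L₀ * S * L₀ * S) = B ^ 2 := by
    rw [hL₀w, trace_vecMulVec_mul_vecMulVec_mul, huw, sq]
  have htrt : trace (L₀ * S * L₀ᵀ * S) = B ^ 2 + Λ := by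
    rw [hL₀t, hL₀w, trace_vecMulVec_mul_vecMulVec_mul, ← hI₀, hww]
  refine ⟨?_, htr, htrt, ?_⟩
  · rw [hL, hL₀t, hL₀w, smul_mul, add_mul, trace_smul, trace_add, trace_vecMulVec_mul,
      trace_vecMulVec_mul, huw, hwu, smul_eq_mul]
    ring
  · have httr : trace (L₀ᵀ * S * L₀ * S) = B ^ 2 + Λ := by
      rw [hL₀t, hL₀w, trace_vecMulVec_mul_vecMulVec_mul, ← hI₀, mul_comm, hww]
    have htt : trace (L₀ᵀ * S * L₀ᵀ * S) = B ^ 2 := by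
      rw [hL₀t, trace_vecMulVec_mul_vecMulVec_mul, hwu, sq]
    rw [hL]
    simp only [Matrix.smul_mul, Matrix.mul_smul, Matrix.add_mul, Matrix.mul_add, trace_smul, trace_add,
      smul_eq_mul, htr, htrt, httr, htt]
    ring
end

section
/- Let f : (ℝ^q)^d → ℝ^q be a combination function that is differentiable, symmetric (f(θ_{σ(1)},…,θ_{σ(d)}) = f(θ_1,…,θ_d) for every permutation σ of {1,…,d} and all arguments), and exactly consistent on the diagonal: f(θ, θ, …, θ) = θ for all θ ∈ ℝ^q. Then for every θ ∈ ℝ^q and every k ∈ {1,…,d}, the partial Jacobian of f with respect to its k-th block argument, evaluated at the diagonal point (θ, θ, …, θ), equals (1/d)·Id_q, the identity map on ℝ^q scaled by 1/d. -/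
/-- The partial map of a symmetric function in one block, around a diagonal point, does not depend
on the block. -/
theorem apply_update_const_eq_of_symmetric {ι E F : Type*} [DecidableEq ι] {f : (ι → E) → F}
    (hsymm : ∀ (σ : Equiv.Perm ι) (y : ι → E), f (fun k => y (σ k)) = f y)
    (θ t : E) (j k : ι) :
    f (Function.update (fun _ => θ) j t) = f (Function.update (fun _ => θ) k t) := by
  rw [← hsymm (Equiv.swap j k) (Function.update (fun _ => θ) k t)]
  congr 1
  ext i
  simp only [Function.update_apply, Equiv.swap_apply_eq_iff, Equiv.swap_apply_right]

/-- A differentiable, symmetric combination function that is exactly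
consistent on the diagonal (`f(θ,…,θ) = θ`) has partial Jacobian `(1/d)·Id` with respect
to each of its `d` block arguments at every diagonal point. -/
theorem symmetric_consistent_combination_diagonal_jacobian {q d : ℕ}
    (f : (Fin d → (Fin q → ℝ)) → (Fin q → ℝ))
    (hdiff : Differentiable ℝ f)
    (hsymm : ∀ (σ : Equiv.Perm (Fin d)) (y : Fin d → (Fin q → ℝ)),
      f (fun k => y (σ k)) = f y)
    (hcons : ∀ θ : Fin q → ℝ, f (fun _ => θ) = θ) :
    ∀ (θ : Fin q → ℝ) (k : Fin d),
      HasFDerivAt (fun t => f (Function.update (fun _ => θ) k t))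
        (((d : ℝ))⁻¹ • ContinuousLinearMap.id ℝ (Fin q → ℝ)) θ := by
  intro θ k
  set L := fderiv ℝ f (fun _ => θ)
  have hL : HasFDerivAt f L (fun _ => θ) := (hdiff _).hasFDerivAt
  have hpartial (j : Fin d) : HasFDerivAt (fun t => f (Function.update (fun _ => θ) j t))
      (L.comp (.single ℝ (fun _ : Fin d => Fin q → ℝ) j)) θ := by
    have hsingle : ContinuousLinearMap.single ℝ (fun _ : Fin d => Fin q → ℝ) j =
        .pi (Pi.single j (.id ℝ (Fin q → ℝ))) := by
      ext v i : 2
      obtain rfl | hij := eq_or_ne i j <;> simp [*]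
    rw [hsingle]
    refine HasFDerivAt.comp θ (g := f) ?_ (hasFDerivAt_update (fun _ => θ) θ)
    rwa [Function.update_eq_self j (fun _ : Fin d => θ)]
  have hpartial_eq (j : Fin d) : L.comp (.single ℝ (fun _ : Fin d => Fin q → ℝ) j) =
      L.comp (.single ℝ (fun _ : Fin d => Fin q → ℝ) k) := by
    refine (hpartial j).unique ?_
    simpa only [apply_update_const_eq_of_symmetric hsymm θ _ j k] using hpartial k
  have hdiag : L.comp (.pi fun _ => .id ℝ (Fin q → ℝ)) = .id ℝ (Fin q → ℝ) := by
    refine HasFDerivAt.unique (f := fun t => f (fun _ => t)) (x := θ) ?_ ?_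
    · exact HasFDerivAt.comp θ (g := f) hL (hasFDerivAt_pi.2 fun _ => hasFDerivAt_id θ)
    · simp only [hcons]
      exact hasFDerivAt_id θ
  have hd : (d : ℝ) ≠ 0 := Nat.cast_ne_zero.2 k.pos.ne'
  convert hpartial k using 1
  rw [inv_smul_eq_iff₀ hd, ← hdiag]
  ext1 v
  calc L (fun _ => v) = L (∑ j, Pi.single j v) := by
        rw [Finset.univ_sum_single (fun _ : Fin d => v)]
    _ = ∑ j, L.comp (.single ℝ (fun _ : Fin d => Fin q → ℝ) j) v := map_sum L _ _
    _ = (d : ℝ) • L.comp (.single ℝ (fun _ : Fin d => Fin q → ℝ) k) v := by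
        simp only [hpartial_eq, Finset.sum_const, Finset.card_univ, Fintype.card_fin,
          Nat.cast_smul_eq_nsmul]
end
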